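/- arXiv:2007.10772 — 6 statements merged into one kernel-verified Lean document; each statement's English description precedes it below -/
import Mathlib

section
/- For every integer n ≥ 1 and all indices 1 ≤ i < j ≤ n, the equality ρ_i ρ_n^i ρ_{j−i} = ρ_j ρ_n^i holds in the monoid M_n. -/
/-- The defining relations of the monoid `M_n`: the generator `k : Fin n` represents `ρ_{k+1}`
(so that `ρ_i` corresponds to the index `i - 1`), and the relations are
`ρ_1 ρ_n ρ_i = ρ_{i+1} ρ_n` for `1 ≤ i ≤ n - 1`. -/
inductive MnRel (n : ℕ) : FreeMonoid (Fin n) → FreeMonoid (Fin n) → Prop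
  | rel (i : ℕ) (h1 : 1 ≤ i) (h2 : i ≤ n - 1) :
      MnRel n
        (FreeMonoid.of ⟨1 - 1, by omega⟩ * FreeMonoid.of ⟨n - 1, by omega⟩ *
          FreeMonoid.of ⟨i - 1, by omega⟩)
        (FreeMonoid.of ⟨i + 1 - 1, by omega⟩ * FreeMonoid.of ⟨n - 1, by omega⟩)

/-- The presented monoid `M_n`. -/
abbrev Mn (n : ℕ) := PresentedMonoid (MnRel n)

/-- The generator `ρ_i` of `M_n`, for `1 ≤ i ≤ n` (junk value `1` out of range). -/
def rho (n : ℕ) (i : ℕ) : Mn n :=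
  if h : 1 ≤ i ∧ i ≤ n then PresentedMonoid.of (MnRel n) ⟨i - 1, by omega⟩ else 1

/-- `a` left-divides `c`: `c = a * b` for some `b`. -/
def LDvd {M : Type*} [Monoid M] (a c : M) : Prop := ∃ b, a * b = c

/-- `a` right-divides `c`: `c = b * a` for some `b`. -/
def RDvd {M : Type*} [Monoid M] (a c : M) : Prop := ∃ b, b * a = c

theorem rho_rel (n i : ℕ) (h1 : 1 ≤ i) (h2 : i + 1 ≤ n) :
    rho n 1 * rho n n * rho n i = rho n (i + 1) * rho n n := by
  have h := Quotient.sound (s := (conGen (MnRel n)).toSetoid)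
    (ConGen.Rel.of _ _ (MnRel.rel (n := n) i h1 (by omega)))
  unfold rho
  rw [dif_pos (by omega), dif_pos (by omega), dif_pos (by omega), dif_pos (by omega)]
  exact h

/-- For `1 ≤ i < j ≤ n`, the equality `ρ_i ρ_n^i ρ_{j-i} = ρ_j ρ_n^i` holds in `M_n`. -/
theorem stmt1 (n i j : ℕ) (hn : 1 ≤ n) (hi : 1 ≤ i) (hij : i < j) (hj : j ≤ n) :
    rho n i * (rho n n) ^ i * rho n (j - i) = rho n j * (rho n n) ^ i := by
  induction i, hi using Nat.le_induction generalizing j with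
  | base =>
    have h := rho_rel n (j - 1) (by omega) (by omega)
    rw [Nat.sub_add_cancel (by omega)] at h
    simpa using h
  | succ i hi ih =>
    have h := rho_rel n (j - 1) (by omega) (by omega)
    rw [Nat.sub_add_cancel (by omega)] at h
    have h' := ih (j - 1) (by omega) (by omega)
    have e : j - 1 - i = j - (i + 1) := by omega
    rw [e] at h'
    calc rho n (i + 1) * rho n n ^ (i + 1) * rho n (j - (i + 1))
        = (rho n (i + 1) * rho n n) * rho n n ^ i * rho n (j - (i + 1)) := by
          rw [pow_succ']; simp only [mul_assoc]
      _ = rho n 1 * rho n n * (rho n i * rho n n ^ i * rho n (j - (i + 1))) := by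
          rw [← rho_rel n i hi (by omega)]; simp only [mul_assoc]
      _ = (rho n 1 * rho n n * rho n (j - 1)) * rho n n ^ i := by
          rw [h']; simp only [mul_assoc]
      _ = rho n j * rho n n ^ (i + 1) := by
          rw [h, pow_succ']; simp only [mul_assoc]
end

section
/- For every integer n ≥ 1, the monoid M_n is left-cancellative (for all a, b, c ∈ M_n, a·b = a·c implies b = c), and moreover any two elements of M_n that admit a common right-multiple admit a right-lcm: if u, v ∈ M_n have a common right-multiple, then there exists m ∈ M_n such that u left-divides m, v left-divides m, and m left-divides every common right-multiple of u and v. -/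
namespace MnProof

variable {n : ℕ}

/-- Zero-based generators. -/
def g (n k : ℕ) : Mn n := if h : k < n then PresentedMonoid.of (MnRel n) ⟨k, h⟩ else 1

lemma psound {a b : FreeMonoid (Fin n)} (h : ConGen.Rel (MnRel n) a b) :
    PresentedMonoid.mk (MnRel n) a = PresentedMonoid.mk (MnRel n) b :=
  PresentedMonoid.mk_eq_mk_iff.2 h

def wt (n : ℕ) : Mn n →* Multiplicative ℕ :=
  PresentedMonoid.lift (fun k : Fin n => Multiplicative.ofAdd (k.1 + 1)) (by
    rintro a b ⟨i, h1, h2⟩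
    simp only [map_mul, FreeMonoid.lift_eval_of, ← ofAdd_add]
    congr 1
    omega)

def w (a : Mn n) : ℕ := Multiplicative.toAdd (wt n a)

lemma w_mul (a b : Mn n) : w (a * b) = w a + w b := by simp [w]

lemma w_one : w (1 : Mn n) = 0 := by simp [w]

lemma w_of (k : Fin n) : w (PresentedMonoid.of (MnRel n) k) = k.1 + 1 := by
  simp [w, wt]

lemma g_fin (k : Fin n) : g n k.1 = PresentedMonoid.of (MnRel n) k := by
  simp [g]

lemma w_g {k : ℕ} (h : k < n) : w (g n k) = k + 1 := by
  have := w_of (⟨k, h⟩ : Fin n)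
  simpa [g, h] using this

lemma g_rel {k : ℕ} (h : k + 1 < n) :
    g n 0 * g n (n - 1) * g n k = g n (k + 1) * g n (n - 1) := by
  have h0 : 0 < n := by omega
  have hl : n - 1 < n := by omega
  have hk : k < n := by omega
  have := PresentedMonoid.mk_eq_mk_iff.2 (ConGen.Rel.of _ _ (MnRel.rel (n := n) (k + 1) (by omega) (by omega)))
  simpa [g, h0, hl, hk, h, PresentedMonoid.of] using this

def D (i : ℕ) (U X : Mn n) : Prop :=
  (i = 0 ∧ U = g n (n - 1) * X) ∨
    ∃ k U', i = k + 1 ∧ U = g n (n - 1) * U' ∧ X = g n k * U'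

def R (i : ℕ) (U : Mn n) (j : ℕ) (V : Mn n) : Prop :=
  (i = j ∧ U = V) ∨ ∃ X, D i U X ∧ D j V X

lemma D.mul {i : ℕ} {U X : Mn n} (h : D i U X) (c : Mn n) : D i (U * c) (X * c) := by
  rcases h with ⟨h, rfl⟩ | ⟨k, U', h, rfl, rfl⟩
  · exact Or.inl ⟨h, by simp [mul_assoc]⟩
  · exact Or.inr ⟨k, U' * c, h, by simp [mul_assoc], by simp [mul_assoc]⟩

lemma D.eq {i : ℕ} {U X : Mn n} (hi : i < n) (h : D i U X) :
    g n i * U = g n 0 * g n (n - 1) * X := by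
  rcases h with ⟨h, rfl⟩ | ⟨k, U', rfl, rfl, rfl⟩
  · subst h; simp [mul_assoc]
  · rw [← mul_assoc, ← g_rel hi]; simp [mul_assoc]

lemma R.symm {i j : ℕ} {U V : Mn n} (h : R i U j V) : R j V i U := by
  rcases h with ⟨h, h'⟩ | ⟨X, h, h'⟩
  · exact Or.inl ⟨h.symm, h'.symm⟩
  · exact Or.inr ⟨X, h', h⟩

def Canc (n N : ℕ) : Prop :=
  ∀ k < n, ∀ a b : Mn n, w (g n k * a) ≤ N → g n k * a = g n k * b → a = b

lemma D.uniq {N i : ℕ} (hn : 1 ≤ n) (hc : Canc n N) {U X Y : Mn n} (hU : w U ≤ N)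
    (h : D i U X) (h' : D i U Y) : X = Y := by
  rcases h with ⟨h, rfl⟩ | ⟨k, U', h, rfl, rfl⟩ <;>
    rcases h' with ⟨h', e⟩ | ⟨k', U'', h', e, rfl⟩
  · exact hc _ (by omega) _ _ hU e
  · omega
  · omega
  · obtain rfl : k = k' := by omega
    rw [hc _ (by omega) _ _ hU e]

abbrev mkL (a : List (Fin n)) : Mn n := PresentedMonoid.mk (MnRel n) (FreeMonoid.ofList a)

def RL (a b : List (Fin n)) : Prop :=
  (a = [] ∧ b = []) ∨
    ∃ i U j V, a = i :: U ∧ b = j :: V ∧ R i.1 (mkL U) j.1 (mkL V)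

lemma mkL_cons (i : Fin n) (U : List (Fin n)) : mkL (i :: U) = g n i.1 * mkL U := by
  rw [g_fin]; rfl

lemma mkL_append (U V : List (Fin n)) : mkL (U ++ V) = mkL U * mkL V := rfl

lemma mkL_surj (a : Mn n) : ∃ U, mkL U = a := by
  induction a using PresentedMonoid.inductionOn with
  | _ a => exact ⟨FreeMonoid.toList a, rfl⟩

lemma RL.refl (a : List (Fin n)) : RL a a := by
  cases a with
  | nil => exact Or.inl ⟨rfl, rfl⟩
  | cons i U => exact Or.inr ⟨i, U, i, U, rfl, rfl, Or.inl ⟨rfl, rfl⟩⟩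

lemma chain {N : ℕ} (hn : 1 ≤ n) (hc : Canc n N) (a b : FreeMonoid (Fin n))
    (h : ConGen.Rel (MnRel n) a b) :
    w (PresentedMonoid.mk (MnRel n) a) ≤ N + 1 → RL a.toList b.toList := by
  induction h with
  | of a b h =>
    intro _
    obtain ⟨i, h1, h2⟩ := h
    refine Or.inr ⟨⟨0, by omega⟩, [⟨n - 1, by omega⟩, ⟨i - 1, by omega⟩],
      ⟨i + 1 - 1, by omega⟩, [⟨n - 1, by omega⟩], rfl, rfl, Or.inr ⟨g n (i - 1), ?_, ?_⟩⟩
    · refine Or.inl ⟨rfl, ?_⟩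
      rw [mkL_cons, mkL_cons]
      change _ * (_ * 1) = _
      simp
    · refine Or.inr ⟨i - 1, 1, ?_, ?_, ?_⟩
      · simp only; omega
      · rw [mkL_cons]; rfl
      · simp
  | refl a => intro _; exact RL.refl _
  | symm h ih =>
    intro hw
    rw [← psound h] at hw
    rcases ih hw with ⟨h1, h2⟩ | ⟨i, U, j, V, h1, h2, h3⟩
    · exact Or.inl ⟨h2, h1⟩
    · exact Or.inr ⟨j, V, i, U, h2, h1, h3.symm⟩
  | @trans a b c h1 h2 ih1 ih2 =>
    intro hw
    have hw2 := hw
    rw [psound h1] at hw2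
    rcases ih1 hw with ⟨e1, e2⟩ | ⟨i, U, j, V, e1, e2, e3⟩ <;>
      rcases ih2 hw2 with ⟨f1, f2⟩ | ⟨i', U', j', V', f1, f2, f3⟩
    · exact Or.inl ⟨e1, f2⟩
    · simp [e2] at f1
    · simp [e2] at f1
    · rw [e2] at f1
      obtain ⟨rfl, rfl⟩ := List.cons.inj f1
      refine Or.inr ⟨i, U, j', V', e1, f2, ?_⟩
      have hb : PresentedMonoid.mk (MnRel n) b = g n j.1 * mkL V := by
        rw [← mkL_cons, ← e2]; rfl
      rw [hb, w_mul, w_g j.2] at hw2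
      rcases e3 with ⟨p, q⟩ | ⟨X, p, q⟩
      · rw [p, q]; exact f3
      · rcases f3 with ⟨p', q'⟩ | ⟨Y, p', q'⟩
        · rw [← p', ← q']; exact Or.inr ⟨X, p, q⟩
        · obtain rfl := D.uniq hn hc (by omega) q p'
          exact Or.inr ⟨X, p, q'⟩
  | @mul a b c d h1 h2 ih1 ih2 =>
    intro hw
    rw [map_mul, w_mul] at hw
    rcases ih1 (by omega) with ⟨e1, e2⟩ | ⟨i, U, j, V, e1, e2, e3⟩
    · rw [FreeMonoid.toList_mul, FreeMonoid.toList_mul, e1, e2]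
      exact ih2 (by omega)
    · rw [FreeMonoid.toList_mul, FreeMonoid.toList_mul, e1, e2]
      refine Or.inr ⟨i, U ++ c.toList, j, V ++ d.toList, rfl, rfl, ?_⟩
      have hcd : mkL c.toList = mkL d.toList := psound h2
      rw [mkL_append, mkL_append, hcd]
      rcases e3 with ⟨p, q⟩ | ⟨X, p, q⟩
      · exact Or.inl ⟨p, by rw [q]⟩
      · exact Or.inr ⟨X * mkL d.toList, p.mul _, q.mul _⟩

lemma chain' {N : ℕ} (hn : 1 ≤ n) (hc : Canc n N) {i j : ℕ} (hi : i < n) (hj : j < n)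
    {U V : Mn n} (h : g n i * U = g n j * V) (hw : w (g n i * U) ≤ N + 1) : R i U j V := by
  obtain ⟨U, rfl⟩ := mkL_surj U
  obtain ⟨V, rfl⟩ := mkL_surj V
  have e1 := mkL_cons ⟨i, hi⟩ U
  have e2 := mkL_cons ⟨j, hj⟩ V
  simp only at e1 e2
  rw [← e1, ← e2] at h
  rw [← e1] at hw
  have := chain hn hc _ _ (PresentedMonoid.mk_eq_mk_iff.1 h) hw
  rcases this with ⟨p, q⟩ | ⟨i', U', j', V', p, q, r⟩
  · simp at p
  · simp only [FreeMonoid.toList_ofList, List.cons.injEq] at p q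
    obtain ⟨rfl, rfl⟩ := p
    obtain ⟨rfl, rfl⟩ := q
    exact r

lemma canc (hn : 1 ≤ n) (N : ℕ) : Canc n N := by
  induction N with
  | zero =>
    intro k hk a b h
    rw [w_mul, w_g hk] at h
    omega
  | succ N ih =>
    intro k hk a b hw h
    rcases chain' hn ih hk hk h hw with ⟨-, h⟩ | ⟨X, p, q⟩
    · exact h
    · rcases p with ⟨e, rfl⟩ | ⟨m, U', e, rfl, rfl⟩ <;>
        rcases q with ⟨e', rfl⟩ | ⟨m', U'', e', rfl, f⟩
      · rfl
      · omega
      · omega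
      · obtain rfl : m = m' := by omega
        rw [w_mul, w_mul, w_g hk, w_g (by omega)] at hw
        rw [ih m (by omega) _ _ (by rw [w_mul, w_g (by omega)]; omega) f]

lemma gcanc (hn : 1 ≤ n) {k : ℕ} (hk : k < n) {a b : Mn n} (h : g n k * a = g n k * b) :
    a = b := canc hn _ k hk a b le_rfl h

lemma R_of (hn : 1 ≤ n) {i j : ℕ} (hi : i < n) (hj : j < n)
    {U V : Mn n} (h : g n i * U = g n j * V) : R i U j V :=
  chain' hn (canc hn (w (g n i * U))) hi hj h (by omega)

lemma cases_g (a : Mn n) : a = 1 ∨ ∃ k < n, ∃ b, a = g n k * b := by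
  obtain ⟨U, rfl⟩ := mkL_surj a
  cases U with
  | nil => exact Or.inl rfl
  | cons i U => exact Or.inr ⟨i.1, i.2, _, mkL_cons i U⟩

lemma lcanc (hn : 1 ≤ n) (a b c : Mn n) (h : a * b = a * c) : b = c := by
  obtain ⟨U, rfl⟩ := mkL_surj a
  induction U with
  | nil => change 1 * b = 1 * c at h; simpa using h
  | cons i U ih =>
    rw [mkL_cons, mul_assoc, mul_assoc] at h
    exact ih (gcanc hn i.2 h)

/-- `m` is a right-lcm of `u`, `v`. -/
def IsL (u v m : Mn n) : Prop := LDvd u m ∧ LDvd v m ∧ ∀ w, LDvd u w → LDvd v w → LDvd m w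

lemma IsL.symm {u v m : Mn n} (h : IsL u v m) : IsL v u m :=
  ⟨h.2.1, h.1, fun w a b => h.2.2 w b a⟩

lemma ldvd_trans {a b c : Mn n} (h : LDvd a b) (h' : LDvd b c) : LDvd a c := by
  obtain ⟨x, rfl⟩ := h
  obtain ⟨y, rfl⟩ := h'
  exact ⟨x * y, by simp [mul_assoc]⟩

lemma ldvd_mul {a b : Mn n} (s : Mn n) (h : LDvd a b) : LDvd (s * a) (s * b) := by
  obtain ⟨x, rfl⟩ := h
  exact ⟨x, by simp [mul_assoc]⟩

lemma ldvd_cancel (hn : 1 ≤ n) {a b s : Mn n} (h : LDvd (s * a) (s * b)) : LDvd a b := by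
  obtain ⟨x, h⟩ := h
  exact ⟨x, lcanc hn s _ _ (by rw [← h, mul_assoc])⟩

lemma IsL.mul (hn : 1 ≤ n) {u v m : Mn n} (s : Mn n) (h : IsL u v m) :
    IsL (s * u) (s * v) (s * m) := by
  refine ⟨ldvd_mul s h.1, ldvd_mul s h.2.1, ?_⟩
  rintro _ ⟨x, rfl⟩ h2
  rw [mul_assoc] at h2 ⊢
  exact ldvd_mul s (h.2.2 _ ⟨x, rfl⟩ (ldvd_cancel hn h2))

lemma lcm_gen_lt (hn : 1 ≤ n) (i : ℕ) : ∀ j, i < j → j < n → ∃ m, IsL (g n i) (g n j) m := by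
  induction i with
  | zero =>
    intro j hij hj
    obtain ⟨k, rfl⟩ : ∃ k, j = k + 1 := ⟨j - 1, by omega⟩
    refine ⟨g n (k + 1) * g n (n - 1), ⟨g n (n - 1) * g n k, ?_⟩, ⟨_, rfl⟩, ?_⟩
    · rw [← g_rel hj, mul_assoc]
    · rintro w ⟨U, hU⟩ ⟨V, hV⟩
      rcases R_of hn (by omega) hj (hU.trans hV.symm) with ⟨h, -⟩ | ⟨X, -, h⟩
      · omega
      · rcases h with ⟨h, -⟩ | ⟨k', U', h, rfl, rfl⟩
        · omega
        · exact ⟨U', by rw [← hV, mul_assoc]⟩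
  | succ i ih =>
    intro j hij hj
    obtain ⟨k, rfl⟩ : ∃ k, j = k + 1 := ⟨j - 1, by omega⟩
    obtain ⟨L, ⟨A, hA⟩, ⟨B, hB⟩, hL⟩ := ih k (by omega) (by omega)
    refine ⟨g n 0 * g n (n - 1) * L, ⟨g n (n - 1) * A, ?_⟩, ⟨g n (n - 1) * B, ?_⟩, ?_⟩
    · rw [← hA, ← mul_assoc, ← g_rel (by omega)]; simp [mul_assoc]
    · rw [← hB, ← mul_assoc, ← g_rel (by omega)]; simp [mul_assoc]
    · rintro w ⟨U, hU⟩ ⟨V, hV⟩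
      rcases R_of hn (by omega) hj (hU.trans hV.symm) with ⟨h, -⟩ | ⟨X, h, h'⟩
      · omega
      · rw [← hU, h.eq (by omega)]
        apply ldvd_mul
        rcases h with ⟨h, -⟩ | ⟨i', U', h, rfl, rfl⟩
        · omega
        rcases h' with ⟨h', -⟩ | ⟨k', V', h', rfl, e⟩
        · omega
        obtain rfl : i = i' := by omega
        obtain rfl : k = k' := by omega
        exact hL _ ⟨_, rfl⟩ ⟨_, e.symm⟩

lemma lcm_gen (hn : 1 ≤ n) {i j : ℕ} (hi : i < n) (hj : j < n) :
    ∃ m, IsL (g n i) (g n j) m := by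
  rcases lt_trichotomy i j with h | h | h
  · exact lcm_gen_lt hn i j h hj
  · subst h
    exact ⟨g n i, ⟨1, mul_one _⟩, ⟨1, mul_one _⟩, fun _ h _ => h⟩
  · obtain ⟨m, hm⟩ := lcm_gen_lt hn j i h hi
    exact ⟨m, hm.symm⟩

lemma lcm_all (hn : 1 ≤ n) (N : ℕ) : ∀ x u v : Mn n, w x ≤ N → LDvd u x → LDvd v x →
    ∃ m, IsL u v m := by
  induction N with
  | zero =>
    intro x u v hx hu hv
    have key : ∀ u : Mn n, LDvd u x → u = 1 := by
      rintro u ⟨c, rfl⟩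
      rcases cases_g u with h | ⟨k, hk, b, rfl⟩
      · exact h
      · rw [w_mul, w_mul, w_g hk] at hx; omega
    rw [key u hu, key v hv]
    exact ⟨1, ⟨1, mul_one _⟩, ⟨1, mul_one _⟩, fun _ h _ => h⟩
  | succ N ih =>
    intro x u v hx hu hv
    have red : ∀ s < n, ∀ a b : Mn n, LDvd (g n s * a) x → LDvd (g n s * b) x →
        ∃ m, IsL (g n s * a) (g n s * b) m := by
      rintro s hs a b ⟨c, hc⟩ hb
      rw [← hc, mul_assoc] at hb hx
      rw [w_mul, w_g hs] at hx
      obtain ⟨m, hm⟩ := ih (a * c) a b (by omega) ⟨c, rfl⟩ (ldvd_cancel hn hb)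
      exact ⟨_, hm.mul hn _⟩
    rcases cases_g u with rfl | ⟨s, hs, u, rfl⟩
    · exact ⟨v, ⟨v, one_mul _⟩, ⟨1, mul_one _⟩, fun _ _ h => h⟩
    rcases cases_g v with rfl | ⟨t, ht, v, rfl⟩
    · exact ⟨_, ⟨1, mul_one _⟩, ⟨_, one_mul _⟩, fun _ h _ => h⟩
    obtain ⟨L, ⟨A, hA⟩, ⟨B, hB⟩, hL⟩ := lcm_gen hn hs ht
    have hLx : LDvd L x := hL x (ldvd_trans ⟨_, rfl⟩ hu) (ldvd_trans ⟨_, rfl⟩ hv)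
    obtain ⟨P, hP⟩ := red s hs u A hu (hA ▸ hLx)
    obtain ⟨Q, hQ⟩ := red t ht v B hv (hB ▸ hLx)
    rw [hA] at hP
    rw [hB] at hQ
    obtain ⟨P', hP'⟩ : LDvd (g n s) P := ldvd_trans ⟨A, hA⟩ hP.2.1
    obtain ⟨Q', hQ'⟩ : LDvd (g n s) Q := ldvd_trans ⟨A, hA⟩ hQ.2.1
    obtain ⟨m, hm⟩ := red s hs P' Q' (hP' ▸ hP.2.2 x hu hLx) (hQ' ▸ hQ.2.2 x hv hLx)
    rw [hP', hQ'] at hm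
    refine ⟨m, ldvd_trans hP.1 hm.1, ldvd_trans hQ.1 hm.2.1, fun y h1 h2 => ?_⟩
    have hLy : LDvd L y := hL y (ldvd_trans ⟨_, rfl⟩ h1) (ldvd_trans ⟨_, rfl⟩ h2)
    exact hm.2.2 y (hP.2.2 y h1 hLy) (hQ.2.2 y h2 hLy)

end MnProof

/-- `M_n` is left-cancellative and admits conditional right-lcms. -/
theorem stmt3 (n : ℕ) (hn : 1 ≤ n) :
    (∀ a b c : Mn n, a * b = a * c → b = c) ∧
    (∀ u v : Mn n, (∃ w, LDvd u w ∧ LDvd v w) →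
      ∃ m, LDvd u m ∧ LDvd v m ∧ ∀ w, LDvd u w → LDvd v w → LDvd m w) := by
  refine ⟨MnProof.lcanc hn, ?_⟩
  rintro u v ⟨x, hu, hv⟩
  exact MnProof.lcm_all hn _ x u v le_rfl hu hv
end

section
/- For every integer n ≥ 1 and all indices 1 ≤ i < j ≤ n, the element (ρ_1 ρ_n)^{n−j+1} ρ_i = ρ_{n−j+i+1} (ρ_1 ρ_n)^{n−j} ρ_j of M_n is the left-lcm of ρ_i and ρ_j: both ρ_i and ρ_j right-divide it, and it right-divides every element of M_n that is right-divided by both ρ_i and ρ_j. -/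
namespace MnAux

/-- The element `ρ_1 ρ_n`. -/
def tt (n : ℕ) : Mn n := rho n 1 * rho n n

lemma rho_eq (n i : ℕ) (h1 : 1 ≤ i) (h2 : i ≤ n) :
    rho n i = PresentedMonoid.of (MnRel n) ⟨i - 1, by omega⟩ := by
  unfold rho
  rw [dif_pos ⟨h1, h2⟩]

lemma basic (n i : ℕ) (h1 : 1 ≤ i) (h2 : i + 1 ≤ n) :
    tt n * rho n i = rho n (i + 1) * rho n n := by
  have h := (PresentedMonoid.mk_eq_mk_iff (rels := MnRel n)).2
    (ConGen.Rel.of _ _ (MnRel.rel (n := n) i h1 (by omega)))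
  unfold tt
  rw [rho_eq n 1 le_rfl (by omega), rho_eq n n (by omega) le_rfl, rho_eq n i h1 (by omega),
    rho_eq n (i + 1) (by omega) h2]
  exact h

lemma lcm_eq (n d : ℕ) : ∀ i j : ℕ, 1 ≤ i → i < j → j + d = n →
    tt n ^ (d + 1) * rho n i = rho n (d + i + 1) * tt n ^ d * rho n j := by
  induction d with
  | zero =>
    intro i j hi hij hj
    obtain rfl : j = n := by omega
    simpa using basic j i hi (by omega)
  | succ d ih =>
    intro i j hi hij hj
    rw [pow_succ, mul_assoc, basic n i hi (by omega), ← mul_assoc,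
      ih (i + 1) (j + 1) (by omega) (by omega) (by omega), mul_assoc,
      ← basic n j (by omega) (by omega), pow_succ]
    have : d + (i + 1) + 1 = d + 1 + i + 1 := by omega
    rw [this]
    simp only [mul_assoc]

/-- The weight homomorphism. -/
def wtHom (n : ℕ) : Mn n →* Multiplicative ℕ :=
  PresentedMonoid.lift (rels := MnRel n) (fun k : Fin n => Multiplicative.ofAdd (k.1 + 1)) (by
    rintro _ _ ⟨i, h1, h2⟩
    simp only [map_mul, FreeMonoid.lift_eval_of, ← ofAdd_add]
    congr 1
    omega)

/-- The weight. -/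
def wt {n : ℕ} (x : Mn n) : ℕ := (wtHom n x).toAdd

lemma wt_mul {n : ℕ} (x y : Mn n) : wt (x * y) = wt x + wt y := by
  simp [wt]

lemma wt_of {n : ℕ} (k : Fin n) : wt (PresentedMonoid.of (MnRel n) k) = k.1 + 1 := by
  simp [wt, wtHom]

lemma wt_rho {n i : ℕ} (h1 : 1 ≤ i) (h2 : i ≤ n) : wt (rho n i) = i := by
  rw [rho_eq n i h1 h2, wt_of]
  simp only
  omega

/-- Ordered elementary relation. -/
def R1 (n : ℕ) (u : Mn n) (i : ℕ) (v : Mn n) (j : ℕ) : Prop :=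
  i < j ∧ ∃ (c : Mn n) (d : ℕ), j + d = n ∧ u = c * tt n ^ (d + 1) ∧
    v = c * (rho n (d + i + 1) * tt n ^ d)

/-- Elementary relation. -/
def RR (n : ℕ) (u : Mn n) (i : ℕ) (v : Mn n) (j : ℕ) : Prop :=
  (i = j ∧ u = v) ∨ R1 n u i v j ∨ R1 n v j u i

lemma RR.symm {n : ℕ} {u v : Mn n} {i j : ℕ} (h : RR n u i v j) : RR n v j u i := by
  rcases h with ⟨h1, h2⟩ | h | h
  · exact Or.inl ⟨h1.symm, h2.symm⟩
  · exact Or.inr (Or.inr h)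
  · exact Or.inr (Or.inl h)

lemma R1.mul {n : ℕ} {u v : Mn n} {i j : ℕ} (a : Mn n) (h : R1 n u i v j) :
    R1 n (a * u) i (a * v) j := by
  obtain ⟨h, c, d, hd, rfl, rfl⟩ := h
  exact ⟨h, a * c, d, hd, by simp only [mul_assoc], by simp only [mul_assoc]⟩

lemma RR.mul {n : ℕ} {u v : Mn n} {i j : ℕ} (a : Mn n) (h : RR n u i v j) :
    RR n (a * u) i (a * v) j := by
  rcases h with ⟨h1, h2⟩ | h | h
  · exact Or.inl ⟨h1, by rw [h2]⟩
  · exact Or.inr (Or.inl (h.mul a))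
  · exact Or.inr (Or.inr (h.mul a))

/-- The main property, for weight below `m`. -/
def HH (n m : ℕ) : Prop := ∀ (u v : Mn n) (i j : ℕ), 1 ≤ i → i ≤ n → 1 ≤ j → j ≤ n →
  wt (u * rho n i) < m → u * rho n i = v * rho n j → RR n u i v j

lemma cancel {n m : ℕ} (H : HH n m) (u v : Mn n) (i : ℕ) (h1 : 1 ≤ i) (h2 : i ≤ n)
    (hw : wt (u * rho n i) < m) (h : u * rho n i = v * rho n i) : u = v := by
  rcases H u v i i h1 h2 h1 h2 hw h with h | h | h
  · exact h.2
  · exact absurd h.1 (lt_irrefl _)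
  · exact absurd h.1 (lt_irrefl _)

lemma cancelT {n m : ℕ} (hn : 1 ≤ n) (H : HH n m) (e : ℕ) : ∀ (u v : Mn n),
    wt (u * tt n ^ e) < m → u * tt n ^ e = v * tt n ^ e → u = v := by
  induction e with
  | zero => intro u v _ h; simpa using h
  | succ e ih =>
    intro u v hw h
    rw [pow_succ, ← mul_assoc] at hw
    rw [pow_succ, ← mul_assoc, ← mul_assoc] at h
    have hw' : wt (u * tt n ^ e) < m := by
      rw [wt_mul] at hw; omega
    refine ih u v hw' ?_
    unfold tt at h hw ⊢
    rw [← mul_assoc] at hw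
    rw [← mul_assoc, ← mul_assoc] at h
    have h' := cancel H _ _ n hn le_rfl hw h
    exact cancel H _ _ 1 le_rfl hn (by rw [wt_mul] at hw; omega) h'

lemma T1 {n m : ℕ} (hn : 1 ≤ n) (H : HH n m) {u v w : Mn n} {i j k : ℕ} (hi : 1 ≤ i)
    (hv : wt v < m) (h : R1 n u i v j) (h' : R1 n v j w k) : R1 n u i w k := by
  obtain ⟨hij, c, d, hd, rfl, hv1⟩ := h
  obtain ⟨hjk, c', d', hd', hv2, rfl⟩ := h'
  obtain ⟨f, rfl⟩ : ∃ f, d = f + (d' + 1) := ⟨d - (d' + 1), by omega⟩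
  have hc : c' = c * rho n (f + (d' + 1) + i + 1) * tt n ^ f := by
    refine cancelT hn H (d' + 1) _ _ (by rwa [← hv2]) ?_
    rw [← hv2, hv1, pow_add]
    simp only [mul_assoc]
  refine ⟨by omega, c * tt n ^ (f + 1), d', hd', ?_, ?_⟩
  · rw [mul_assoc, ← pow_add]; congr 2; omega
  · have e := lcm_eq n f (d' + i + 1) (d' + j + 1) (by omega) (by omega) (by omega)
    rw [hc]
    have e2 : f + (d' + i + 1) + 1 = f + (d' + 1) + i + 1 := by omega
    rw [e2] at e
    calc _ = c * (rho n (f + (d' + 1) + i + 1) * tt n ^ f * rho n (d' + j + 1)) * tt n ^ d' := by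
          simp only [mul_assoc]
      _ = _ := by rw [← e]; simp only [mul_assoc]

lemma T2aux {n : ℕ} {c c' : Mn n} {i k d : ℕ}
    (h : R1 n c (d + i + 1) c' (d + k + 1)) :
    R1 n (c * tt n ^ (d + 1)) i (c' * tt n ^ (d + 1)) k := by
  obtain ⟨hik, e, f, hf, rfl, rfl⟩ := h
  refine ⟨by omega, e, f + (d + 1), by omega, ?_, ?_⟩
  · rw [mul_assoc, ← pow_add]; congr 2; omega
  · have e2 : f + (d + i + 1) + 1 = f + (d + 1) + i + 1 := by omega
    rw [e2, pow_add _ f (d + 1)]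
    simp only [mul_assoc]

lemma T2 {n m : ℕ} (hn : 1 ≤ n) (H : HH n m) {u v w : Mn n} {i j k : ℕ}
    (hv : wt v < m) (h : R1 n u i v j) (h' : R1 n w k v j) : RR n u i w k := by
  obtain ⟨hij, c, d, hd, rfl, hv1⟩ := h
  obtain ⟨hkj, c', d', hd', rfl, hv2⟩ := h'
  obtain rfl : d' = d := by omega
  rw [← mul_assoc] at hv1 hv2
  have e := cancelT hn H d' _ _ (by rwa [← hv1]) (hv1.symm.trans hv2)
  have hw : wt (c * rho n (d' + i + 1)) < m := by
    rw [hv1, wt_mul] at hv; omega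
  rcases H c c' _ _ (by omega) (by omega) (by omega) (by omega) hw e with h | h | h
  · exact Or.inl ⟨by omega, by rw [h.2]⟩
  · exact Or.inr (Or.inl (T2aux h))
  · exact Or.inr (Or.inr (T2aux h))

lemma T3aux {n m : ℕ} (hn : 1 ≤ n) (H : HH n m) {u v w : Mn n} {i j k : ℕ} (hj : 1 ≤ j)
    (hv : wt v < m) (h : R1 n v j u i) (h' : R1 n v j w k) (hik : i < k) : R1 n u i w k := by
  obtain ⟨hji, c, d, hd, hv1, rfl⟩ := h
  obtain ⟨hjk, c', d', hd', hv2, rfl⟩ := h'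
  obtain ⟨f, rfl⟩ : ∃ f, d = f + (d' + 1) := ⟨d - (d' + 1), by omega⟩
  have hc : c' = c * tt n ^ (f + 1) := by
    refine cancelT hn H (d' + 1) _ _ (by rwa [← hv2]) ?_
    rw [← hv2, hv1, mul_assoc, ← pow_add]
    congr 2; omega
  refine ⟨hik, c * rho n (f + (d' + 1) + j + 1) * tt n ^ f, d', hd', ?_, ?_⟩
  · rw [pow_add]; simp only [mul_assoc]
  · have e := lcm_eq n f (d' + j + 1) (d' + i + 1) (by omega) (by omega) (by omega)
    have e2 : f + (d' + j + 1) + 1 = f + (d' + 1) + j + 1 := by omega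
    rw [e2] at e
    calc _ = c * (tt n ^ (f + 1) * rho n (d' + j + 1)) * tt n ^ d' := by
          rw [hc]; simp only [mul_assoc]
      _ = _ := by rw [e]; simp only [mul_assoc]

lemma T3 {n m : ℕ} (hn : 1 ≤ n) (H : HH n m) {u v w : Mn n} {i j k : ℕ} (hj : 1 ≤ j)
    (hv : wt v < m) (h : R1 n v j u i) (h' : R1 n v j w k) : RR n u i w k := by
  rcases lt_trichotomy i k with hik | hik | hik
  · exact Or.inr (Or.inl (T3aux hn H hj hv h h' hik))
  · subst hik
    obtain ⟨hji, c, d, hd, hv1, rfl⟩ := h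
    obtain ⟨hjk, c', d', hd', hv2, rfl⟩ := h'
    obtain rfl : d' = d := by omega
    have e := cancelT hn H _ _ _ (by rwa [← hv1]) (hv1.symm.trans hv2)
    exact Or.inl ⟨rfl, by rw [e]⟩
  · exact Or.inr (Or.inr (T3aux hn H hj hv h' h hik))

lemma RR.trans {n m : ℕ} (hn : 1 ≤ n) (H : HH n m) {u v w : Mn n} {i j k : ℕ} (hi : 1 ≤ i)
    (hj : 1 ≤ j) (hk : 1 ≤ k) (hv : wt v < m) (h : RR n u i v j) (h' : RR n v j w k) :
    RR n u i w k := by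
  rcases h with ⟨rfl, rfl⟩ | h | h
  · exact h'
  · rcases h' with ⟨rfl, rfl⟩ | h' | h'
    · exact Or.inr (Or.inl h)
    · exact Or.inr (Or.inl (T1 hn H hi hv h h'))
    · exact T2 hn H hv h h'
  · rcases h' with ⟨rfl, rfl⟩ | h' | h'
    · exact Or.inr (Or.inr h)
    · exact T3 hn H hj hv h h'
    · exact Or.inr (Or.inr (T1 hn H hk hv h' h))

/-- The projection. -/
abbrev pr (n : ℕ) : FreeMonoid (Fin n) →* Mn n := PresentedMonoid.mk (MnRel n)

lemma wt_pr_of {n : ℕ} (k : Fin n) : wt (pr n (FreeMonoid.of k)) = k.1 + 1 := wt_of k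

lemma last_cases {n : ℕ} (x : FreeMonoid (Fin n)) :
    x = 1 ∨ ∃ (a : FreeMonoid (Fin n)) (k : Fin n), x = a * FreeMonoid.of k := by
  rcases List.eq_nil_or_concat x.toList with h | ⟨l, k, h⟩
  · exact Or.inl (FreeMonoid.toList.injective h)
  · exact Or.inr ⟨FreeMonoid.ofList l, k, FreeMonoid.toList.injective (by simpa using h)⟩

lemma last_inj {n : ℕ} {a b : FreeMonoid (Fin n)} {k l : Fin n}
    (h : a * FreeMonoid.of k = b * FreeMonoid.of l) : a = b ∧ k = l := by
  have h' := congrArg FreeMonoid.toList h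
  simp only [FreeMonoid.toList_mul, FreeMonoid.toList_of] at h'
  have := List.append_inj' h' rfl
  exact ⟨FreeMonoid.toList.injective this.1, by simpa using this.2⟩

lemma wt_pos {n : ℕ} {a : FreeMonoid (Fin n)} {k : Fin n} :
    0 < wt (pr n (a * FreeMonoid.of k)) := by
  rw [map_mul, wt_mul, wt_pr_of]; omega

lemma wt_one {n : ℕ} : wt (pr n 1) = 0 := by
  simp [wt]

lemma step {n m : ℕ} (hn : 1 ≤ n) (H : HH n m) (x y : FreeMonoid (Fin n))
    (h : ConGen.Rel (MnRel n) x y) :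
    wt (pr n x) ≤ m → ∀ (a b : FreeMonoid (Fin n)) (k l : Fin n), x = a * FreeMonoid.of k →
      y = b * FreeMonoid.of l → RR n (pr n a) (k.1 + 1) (pr n b) (l.1 + 1) := by
  have key : ∀ {x y : FreeMonoid (Fin n)}, ConGen.Rel (MnRel n) x y → pr n x = pr n y :=
    fun h => PresentedMonoid.mk_eq_mk_iff.2 h
  induction h with
  | of x y h =>
    intro _ a b k l ha hb
    obtain ⟨i, h1, h2⟩ := h
    obtain ⟨rfl, rfl⟩ := last_inj ha
    obtain ⟨rfl, rfl⟩ := last_inj hb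
    refine Or.inr (Or.inl ⟨by simp only; omega, 1, 0, by simp only; omega, ?_, ?_⟩)
    · simp only [map_mul, tt, rho_eq n 1 le_rfl hn, rho_eq n n hn le_rfl, zero_add, pow_one,
        one_mul]
      rfl
    · have e : 0 + (i - 1 + 1) + 1 = i + 1 := by omega
      simp only [e, rho_eq n (i + 1) (by omega) (by omega), pow_zero, mul_one, one_mul]
      rfl
  | refl x =>
    intro _ a b k l ha hb
    obtain ⟨rfl, rfl⟩ := last_inj (ha.symm.trans hb)
    exact Or.inl ⟨rfl, rfl⟩
  | symm h ih =>
    intro hw a b k l ha hb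
    rw [← key h] at hw
    exact (ih hw b a l k hb ha).symm
  | @trans x y z h h' ih ih' =>
    intro hw a b k l ha hb
    have hw' := hw
    rw [key h] at hw'
    rcases last_cases y with rfl | ⟨c, p, hc⟩
    · have := key h
      subst ha
      have h3 := wt_pos (a := a) (k := k)
      rw [this, wt_one] at h3
      omega
    · refine RR.trans hn H (by omega) (by omega) (by omega) ?_ (ih hw a c k p ha hc)
        (ih' hw' c b p l hc hb)
      rw [hc, map_mul, wt_mul, wt_pr_of] at hw'
      omega
  | @mul x y x' y' h h' ih ih' =>
    intro hw a b k l ha hb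
    rw [map_mul, wt_mul] at hw
    have e' := key h'
    rcases last_cases x' with rfl | ⟨c, p, rfl⟩
    · rcases last_cases y' with rfl | ⟨c', q, rfl⟩
      · exact ih (by omega) a b k l (by simpa using ha) (by simpa using hb)
      · have h3 := wt_pos (a := c') (k := q)
        rw [← e', wt_one] at h3
        omega
    · rcases last_cases y' with rfl | ⟨c', q, rfl⟩
      · have h3 := wt_pos (a := c) (k := p)
        rw [e', wt_one] at h3
        omega
      · rw [← mul_assoc] at ha hb
        obtain ⟨rfl, rfl⟩ := last_inj ha
        obtain ⟨rfl, rfl⟩ := last_inj hb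
        rw [map_mul, map_mul, ← key h]
        exact (ih' (by omega) c c' p q rfl rfl).mul _

lemma main (n : ℕ) (hn : 1 ≤ n) (m : ℕ) : HH n m := by
  induction m with
  | zero => intro u v i j _ _ _ _ h; omega
  | succ m ih =>
    intro u v i j hi hi' hj hj' hw h
    obtain ⟨a, rfl⟩ := PresentedMonoid.surjective_mk (rels := MnRel n) u
    obtain ⟨b, rfl⟩ := PresentedMonoid.surjective_mk (rels := MnRel n) v
    rw [rho_eq n i hi hi'] at h hw
    rw [rho_eq n j hj hj'] at h
    have h' : pr n (a * FreeMonoid.of ⟨i - 1, by omega⟩) =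
        pr n (b * FreeMonoid.of ⟨j - 1, by omega⟩) := by
      rw [map_mul, map_mul]; exact h
    have := step hn ih _ _ (PresentedMonoid.mk_eq_mk_iff.1 h')
      (by rw [map_mul]; exact Nat.lt_succ_iff.1 hw) a b _ _ rfl rfl
    simpa only [Nat.sub_add_cancel hi, Nat.sub_add_cancel hj] using this

end MnAux

/-- For `1 ≤ i < j ≤ n`, the element `(ρ_1 ρ_n)^{n-j+1} ρ_i = ρ_{n-j+i+1} (ρ_1 ρ_n)^{n-j} ρ_j`
is the left-lcm of `ρ_i` and `ρ_j` in `M_n`. -/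
theorem stmt6 (n i j : ℕ) (hn : 1 ≤ n) (hi : 1 ≤ i) (hij : i < j) (hj : j ≤ n) :
    (rho n 1 * rho n n) ^ (n - j + 1) * rho n i =
      rho n (n - j + i + 1) * (rho n 1 * rho n n) ^ (n - j) * rho n j ∧
    RDvd (rho n i) ((rho n 1 * rho n n) ^ (n - j + 1) * rho n i) ∧
    RDvd (rho n j) ((rho n 1 * rho n n) ^ (n - j + 1) * rho n i) ∧
    (∀ w : Mn n, RDvd (rho n i) w → RDvd (rho n j) w →
      RDvd ((rho n 1 * rho n n) ^ (n - j + 1) * rho n i) w) := by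
  have e := MnAux.lcm_eq n (n - j) i j hi hij (by omega)
  unfold MnAux.tt at e
  refine ⟨e, ⟨_, rfl⟩, ⟨_, e.symm⟩, ?_⟩
  rintro w ⟨u, hu⟩ ⟨v, hv⟩
  rcases MnAux.main n hn (MnAux.wt (u * rho n i) + 1) u v i j hi (by omega) (by omega) hj
    (by omega) (hu.trans hv.symm) with h | h | h
  · omega
  · obtain ⟨_, c, d, hd, rfl, _⟩ := h
    obtain rfl : d = n - j := by omega
    refine ⟨c, ?_⟩
    rw [← hu, ← mul_assoc]
    rfl
  · have := h.1
    omega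
end

section
/- For every integer n ≥ 1, in the monoid M_n with Δ = ρ_n^{n+1}, the set of left-divisors of Δ coincides with the set of right-divisors of Δ, and this set is finite. -/
section Helpers

variable {n : ℕ}

/-- Weight homomorphism, with weight i for the i-th generator. -/
def wtHom (n : ℕ) : Mn n →* Multiplicative ℕ :=
  PresentedMonoid.lift (fun k : Fin n => Multiplicative.ofAdd (k.val + 1)) (by
    rintro a b ⟨i, h1, h2⟩
    simp only [map_mul, FreeMonoid.lift_eval_of, ← ofAdd_add]
    congr 1
    omega)

def wt (a : Mn n) : ℕ := Multiplicative.toAdd (wtHom n a)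

lemma wt_mul (a b : Mn n) : wt (a * b) = wt a + wt b := by simp [wt]

lemma wt_one : wt (1 : Mn n) = 0 := by simp [wt]

lemma wt_of (k : Fin n) : wt (PresentedMonoid.of (MnRel n) k) = k.val + 1 := by
  simp [wt, wtHom]

lemma rho_fin (k : Fin n) : rho n (k.val + 1) = PresentedMonoid.of (MnRel n) k := by
  have : 1 ≤ k.val + 1 ∧ k.val + 1 ≤ n := by omega
  simp [rho]

lemma wt_rho (i : ℕ) (h1 : 1 ≤ i) (h2 : i ≤ n) : wt (rho n i) = i := by
  have := wt_of (⟨i - 1, by omega⟩ : Fin n)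
  rw [rho, dif_pos ⟨h1, h2⟩, this]
  simp only
  omega

lemma base_rel (i : ℕ) (h1 : 1 ≤ i) (h2 : i < n) :
    rho n 1 * rho n n * rho n i = rho n (i + 1) * rho n n := by
  have h := PresentedMonoid.mk_eq_mk_of_rel (MnRel.rel (n := n) i h1 (by omega))
  rw [rho, dif_pos ⟨le_rfl, by omega⟩, rho, dif_pos ⟨by omega, le_rfl⟩, rho, dif_pos ⟨h1, h2.le⟩, rho,
    dif_pos ⟨by omega, by omega⟩]
  exact h

lemma x_pow_rel (m k : ℕ) (h1 : 1 ≤ k) (h2 : k + m ≤ n) :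
    (rho n 1 * rho n n) ^ m * rho n k = rho n (k + m) * rho n n ^ m := by
  induction m with
  | zero => simp
  | succ m ih =>
    rw [pow_succ', mul_assoc, ih (by omega), ← mul_assoc, base_rel (k + m) (by omega) (by omega),
      pow_succ', ← mul_assoc, add_assoc]

lemma x_pow_eq (i : ℕ) (h1 : 1 ≤ i) (h2 : i ≤ n) :
    rho n i * rho n n ^ i = (rho n 1 * rho n n) ^ i := by
  obtain ⟨m, rfl⟩ : ∃ m, i = m + 1 := ⟨i - 1, by omega⟩
  have h := x_pow_rel (n := n) m 1 le_rfl (by omega)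
  rw [pow_succ (rho n n), ← mul_assoc, add_comm m 1, ← h, mul_assoc, add_comm 1 m, pow_succ]

/-- The derived complement relations. -/
lemma compl_rel (i j : ℕ) (h1 : 1 ≤ i) (h2 : i < j) (h3 : j ≤ n) :
    rho n i * (rho n n ^ i * rho n (j - i)) = rho n j * rho n n ^ i := by
  rw [← mul_assoc, x_pow_eq i h1 (by omega), x_pow_rel i (j - i) (by omega) (by omega)]
  congr 2
  omega

lemma delta_eq (hn : 1 ≤ n) : rho n n ^ (n + 1) = (rho n 1 * rho n n) ^ n := by
  rw [pow_succ', x_pow_eq n hn le_rfl]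

lemma delta_comm_rho (i : ℕ) (h1 : 1 ≤ i) (h2 : i ≤ n) :
    rho n n ^ (n + 1) * rho n i = rho n i * rho n n ^ (n + 1) := by
  have e : n = i + (n - i) := by omega
  have a := x_pow_rel (n := n) (n - i) i h1 (by omega)
  rw [← e] at a
  rw [delta_eq (by omega)]
  conv_lhs => rw [show (rho n 1 * rho n n) ^ n =
    (rho n 1 * rho n n) ^ i * (rho n 1 * rho n n) ^ (n - i) by rw [← pow_add, ← e]]
  rw [mul_assoc, a, ← delta_eq (by omega), ← x_pow_eq i h1 h2, mul_assoc, ← pow_succ', ← pow_add]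
  congr 2
  omega

lemma mn_induction {p : Mn n → Prop} (h1 : p 1)
    (hc : ∀ (k : Fin n) (a : Mn n), p a → p (rho n (k.val + 1) * a)) (a : Mn n) : p a := by
  induction a using PresentedMonoid.inductionOn with
  | _ w =>
    induction w using FreeMonoid.inductionOn' with
    | one => exact h1
    | of_mul k w ih =>
      rw [map_mul]
      have := hc k _ ih
      rw [rho_fin] at this
      exact this

lemma delta_central (a : Mn n) : rho n n ^ (n + 1) * a = a * rho n n ^ (n + 1) := by
  induction a using mn_induction with
  | h1 => simp
  | hc k a ih =>
    rw [← mul_assoc, delta_comm_rho _ (by omega) (by omega), mul_assoc, ih, mul_assoc]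

/-- Local form of the equality of two words with first letters i and j. -/
def RR (i : ℕ) (U : Mn n) (j : ℕ) (V : Mn n) : Prop :=
  (i = j ∧ U = V) ∨
  (i < j ∧ ∃ t, U = rho n n ^ i * (rho n (j - i) * t) ∧ V = rho n n ^ i * t) ∨
  (j < i ∧ ∃ t, V = rho n n ^ j * (rho n (i - j) * t) ∧ U = rho n n ^ j * t)

lemma RR.symm {i j : ℕ} {U V : Mn n} (h : RR i U j V) : RR j V i U := by
  rcases h with ⟨rfl, rfl⟩ | h | h
  · exact Or.inl ⟨rfl, rfl⟩
  · exact Or.inr (Or.inr h)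
  · exact Or.inr (Or.inl h)

lemma RR.mul {i j : ℕ} {U V : Mn n} (h : RR i U j V) (W : Mn n) : RR i (U * W) j (V * W) := by
  rcases h with ⟨rfl, rfl⟩ | ⟨h, t, rfl, rfl⟩ | ⟨h, t, rfl, rfl⟩
  · exact Or.inl ⟨rfl, rfl⟩
  · exact Or.inr (Or.inl ⟨h, t * W, by simp only [mul_assoc], by simp only [mul_assoc]⟩)
  · exact Or.inr (Or.inr ⟨h, t * W, by simp only [mul_assoc], by simp only [mul_assoc]⟩)

def CC (n N : ℕ) : Prop := ∀ i j : ℕ, 1 ≤ i → i ≤ n → 1 ≤ j → j ≤ n → ∀ U V : Mn n,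
  rho n i * U = rho n j * V → wt (rho n i * U) < N → RR i U j V

lemma CC.cancel {N : ℕ} (h : CC n N) {i : ℕ} (h1 : 1 ≤ i) (h2 : i ≤ n) {U V : Mn n}
    (e : rho n i * U = rho n i * V) (hw : wt (rho n i * U) < N) : U = V := by
  rcases h i i h1 h2 h1 h2 U V e hw with ⟨_, h⟩ | ⟨h, _⟩ | ⟨h, _⟩
  · exact h
  · omega
  · omega

lemma CC.cancel_pow {N : ℕ} (h : CC n N) (hn : 1 ≤ n) (m : ℕ) {U V : Mn n}
    (e : rho n n ^ m * U = rho n n ^ m * V) (hw : wt (rho n n ^ m * U) < N) : U = V := by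
  induction m with
  | zero => simpa using e
  | succ m ih =>
    rw [pow_succ', mul_assoc, mul_assoc] at e
    rw [pow_succ', mul_assoc] at hw
    refine ih (h.cancel hn le_rfl e hw) ?_
    rw [wt_mul] at hw
    omega

lemma compl_rel' (i j : ℕ) (h1 : 1 ≤ i) (h2 : i < j) (h3 : j ≤ n) (t : Mn n) :
    rho n i * (rho n n ^ i * (rho n (j - i) * t)) = rho n j * (rho n n ^ i * t) := by
  have := compl_rel i j h1 h2 h3
  simp only [← mul_assoc] at this ⊢
  rw [this]

lemma pow_split (i j : ℕ) (h : i ≤ j) (t : Mn n) :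
    rho n n ^ j * t = rho n n ^ i * (rho n n ^ (j - i) * t) := by
  rw [← mul_assoc, ← pow_add]
  congr 2
  omega

/-- The case of RR.trans with i ≤ k. -/
lemma RR.trans_aux {N : ℕ} (hC : CC n N) {i j k : ℕ} {U V W : Mn n} (hi : 1 ≤ i) (hi' : i ≤ n)
    (hj : 1 ≤ j) (hj' : j ≤ n) (hk : 1 ≤ k) (hk' : k ≤ n) (hV : wt V < N) (hik : i ≤ k)
    (h1 : RR i U j V) (h2 : RR j V k W) : RR i U k W := by
  have hn : 1 ≤ n := by omega
  rcases h1 with ⟨rfl, rfl⟩ | ⟨hij, t, rfl, rfl⟩ | ⟨hij, t, rfl, rfl⟩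
  · exact h2
  · rcases h2 with ⟨rfl, rfl⟩ | ⟨hjk, s, e, rfl⟩ | ⟨hjk, s, rfl, e⟩
    · exact Or.inr (Or.inl ⟨hij, t, rfl, rfl⟩)
    · rw [pow_split i j hij.le] at e
      have e' := hC.cancel_pow hn i e hV
      subst e'
      refine Or.inr (Or.inl ⟨by omega, rho n n ^ (j - i) * s, ?_, pow_split i j hij.le s⟩)
      have := compl_rel' (n := n) (j - i) (k - i) (by omega) (by omega) (by omega) s
      rw [show k - i - (j - i) = k - j by omega] at this
      rw [this]
    · rw [pow_split i k hik] at e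
      have e' := hC.cancel_pow hn i e hV
      subst e'
      rcases hik.eq_or_lt with rfl | hik
      · refine Or.inl ⟨rfl, ?_⟩
        simp
      · refine Or.inr (Or.inl ⟨hik, rho n n ^ (k - i) * (rho n (j - k) * s), ?_, pow_split i k hik.le _⟩)
        have := compl_rel' (n := n) (k - i) (j - i) (by omega) (by omega) (by omega) s
        rw [show j - i - (k - i) = j - k by omega] at this
        rw [this]
  · rcases h2 with ⟨rfl, rfl⟩ | ⟨hjk, s, e, rfl⟩ | ⟨hjk, s, rfl, e⟩
    · exact Or.inr (Or.inr ⟨hij, t, rfl, rfl⟩)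
    · have e' := hC.cancel_pow hn j e hV
      have hw : wt (rho n (i - j) * t) < N := by
        rw [wt_mul] at hV
        omega
      rcases hC (i - j) (k - j) (by omega) (by omega) (by omega) (by omega) _ _ e' hw with
        ⟨h, rfl⟩ | ⟨h, r, rfl, rfl⟩ | ⟨h, _⟩
      · exact Or.inl ⟨by omega, rfl⟩
      · refine Or.inr (Or.inl ⟨by omega, r, ?_, ?_⟩)
        · rw [pow_split j i hij.le, show k - j - (i - j) = k - i by omega]
        · rw [pow_split j i hij.le]
      · omega
    · omega

lemma RR.trans {N : ℕ} (hC : CC n N) {i j k : ℕ} {U V W : Mn n} (hi : 1 ≤ i) (hi' : i ≤ n)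
    (hj : 1 ≤ j) (hj' : j ≤ n) (hk : 1 ≤ k) (hk' : k ≤ n) (hV : wt V < N)
    (h1 : RR i U j V) (h2 : RR j V k W) : RR i U k W := by
  rcases le_total i k with h | h
  · exact RR.trans_aux hC hi hi' hj hj' hk hk' hV h h1 h2
  · exact (RR.trans_aux hC hk hk' hj hj' hi hi' hV h h2.symm h1.symm).symm

/-- Class of a word. -/
def cls (w : List (Fin n)) : Mn n := PresentedMonoid.mk (MnRel n) (FreeMonoid.ofList w)

lemma cls_nil : cls ([] : List (Fin n)) = 1 := rfl

lemma cls_cons (a : Fin n) (w : List (Fin n)) : cls (a :: w) = rho n (a.val + 1) * cls w := by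
  rw [rho_fin]; rfl

lemma cls_append (v w : List (Fin n)) : cls (v ++ w) = cls v * cls w := rfl

lemma length_le_wt (w : List (Fin n)) : w.length ≤ wt (cls w) := by
  induction w with
  | nil => simp
  | cons a w ih =>
    rw [cls_cons, wt_mul, wt_rho _ (by omega) (by omega), List.length_cons]
    omega

def EE : List (Fin n) → List (Fin n) → Prop
  | [], [] => True
  | a :: u, b :: v => RR (a.val + 1) (cls u) (b.val + 1) (cls v)
  | _, _ => False

lemma EE_of_rel {N : ℕ} (hC : CC n N) {v w : FreeMonoid (Fin n)} (h : ConGen.Rel (MnRel n) v w) :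
    cls v.toList = cls w.toList ∧ (wt (cls v.toList) ≤ N → EE v.toList w.toList) := by
  induction h with
  | of v w h =>
    refine ⟨PresentedMonoid.mk_eq_mk_of_rel h, fun _ => ?_⟩
    obtain ⟨i, h1, h2⟩ := h
    refine Or.inr (Or.inl ⟨by simp only; omega, 1, ?_, ?_⟩)
    · change cls [_, _] = _
      simp only [cls_cons, cls_nil]
      rw [show n - 1 + 1 = n by omega, show i - 1 + 1 = i by omega,
        show i + 1 - 1 + 1 - (1 - 1 + 1) = i by omega, show 1 - 1 + 1 = 1 by omega, pow_one]
    · change cls [_] = _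
      simp only [cls_cons, cls_nil]
      rw [show n - 1 + 1 = n by omega, show 1 - 1 + 1 = 1 by omega, pow_one]
  | refl v =>
    refine ⟨rfl, fun _ => ?_⟩
    cases v.toList with
    | nil => trivial
    | cons a u => exact Or.inl ⟨rfl, rfl⟩
  | symm _ ih =>
    refine ⟨ih.1.symm, fun hw => ?_⟩
    have := ih.2 (ih.1 ▸ hw)
    revert this
    generalize FreeMonoid.toList _ = p
    generalize FreeMonoid.toList _ = q
    intro this
    match p, q, this with
    | [], [], _ => trivial
    | a :: u, b :: v, h => exact RR.symm h
  | trans _ _ ih1 ih2 =>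
    obtain ⟨e1, h1⟩ := ih1
    obtain ⟨e2, h2⟩ := ih2
    refine ⟨e1.trans e2, fun hw => ?_⟩
    have h1 := h1 hw
    rw [e1] at hw
    have h2 := h2 hw
    revert h1 h2 hw
    clear e1 e2
    generalize FreeMonoid.toList _ = p
    generalize FreeMonoid.toList _ = q
    generalize FreeMonoid.toList _ = r
    intro hw h1 h2
    match p, q, r, h1, h2 with
    | [], [], [], _, _ => trivial
    | a :: u, b :: v, c :: w, h1, h2 =>
      refine RR.trans hC (by omega) (by omega) (by omega) (by omega) (by omega) (by omega) ?_ h1 h2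
      rw [cls_cons, wt_mul, wt_rho _ (by omega) (by omega)] at hw
      omega
  | @mul p q r s _ _ ih1 ih2 =>
    obtain ⟨e1, h1⟩ := ih1
    obtain ⟨e2, h2⟩ := ih2
    simp only [FreeMonoid.toList_mul, cls_append, wt_mul]
    refine ⟨by rw [e1, e2], fun hw => ?_⟩
    have h1 := h1 (by omega)
    have h2 := h2 (by omega)
    revert h1 h2 e2
    clear hw e1
    generalize p.toList = p
    generalize q.toList = q
    generalize r.toList = r
    generalize s.toList = s
    intro e2 h1 h2
    match p, q, h1 with
    | [], [], _ => exact h2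
    | a :: u, b :: v, h1 =>
      have h3 := RR.mul h1 (cls r)
      simp only [List.cons_append]
      change RR _ (cls u * cls r) _ (cls v * cls s)
      rw [← e2]
      exact h3

lemma CC_all (N : ℕ) : CC n N := by
  induction N with
  | zero => intro i j _ _ _ _ U V _ h; omega
  | succ N ih =>
    intro i j hi hi' hj hj' U V e hw
    induction U using PresentedMonoid.inductionOn with
    | _ u =>
    induction V using PresentedMonoid.inductionOn with
    | _ v =>
    obtain ⟨a, rfl⟩ : ∃ a : Fin n, i = a.val + 1 := ⟨⟨i - 1, by omega⟩, by simp only; omega⟩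
    obtain ⟨b, rfl⟩ : ∃ b : Fin n, j = b.val + 1 := ⟨⟨j - 1, by omega⟩, by simp only; omega⟩
    have e' : cls (a :: u.toList) = cls (b :: v.toList) := by
      rw [cls_cons, cls_cons]; exact e
    have hw' : wt (cls (a :: u.toList)) ≤ N := by
      rw [cls_cons]; exact Nat.lt_succ_iff.mp hw
    have r : ConGen.Rel (MnRel n) (FreeMonoid.ofList (a :: u.toList)) (FreeMonoid.ofList (b :: v.toList)) :=
      Quotient.exact e'
    exact (EE_of_rel ih r).2 hw'

lemma left_cancel (a U V : Mn n) (h : a * U = a * V) : U = V := by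
  induction a using mn_induction with
  | h1 => simpa using h
  | hc k a ih =>
    rw [mul_assoc, mul_assoc] at h
    exact ih ((CC_all _).cancel (by omega) (by omega) h (Nat.lt_succ_self _))

end Helpers

/-- The set of left-divisors of `Δ = ρ_n^{n+1}` in `M_n` coincides with the set of its
right-divisors, and this set is finite. -/
theorem stmt8 (n : ℕ) (hn : 1 ≤ n) :
    {a : Mn n | LDvd a ((rho n n) ^ (n + 1))} = {a : Mn n | RDvd a ((rho n n) ^ (n + 1))} ∧
    {a : Mn n | LDvd a ((rho n n) ^ (n + 1))}.Finite := by
  have key : ∀ a b : Mn n, a * b = rho n n ^ (n + 1) → b * a = rho n n ^ (n + 1) := by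
    intro a b h
    apply left_cancel a
    rw [← mul_assoc, h, delta_central]
  refine ⟨?_, ?_⟩
  · ext a
    exact ⟨fun ⟨b, h⟩ => ⟨b, key a b h⟩, fun ⟨b, h⟩ => ⟨b, key b a h⟩⟩
  · refine ((List.finite_length_le (Fin n) (wt (rho n n ^ (n + 1)))).image cls).subset ?_
    rintro a ⟨b, h⟩
    induction a using PresentedMonoid.inductionOn with
    | _ w =>
    refine ⟨w.toList, ?_, rfl⟩
    have h1 := length_le_wt w.toList
    have h2 : wt (cls w.toList * b) = wt (rho n n ^ (n + 1)) := congrArg wt h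
    rw [wt_mul] at h2
    simp only [Set.mem_ofPred_eq]
    omega
end

section
/- For every integer n ≥ 1, the assignment ρ_i ↦ x^i y^{−i} (for 1 ≤ i ≤ n) extends to a group isomorphism from the group defined by the presentation with generators ρ_1, …, ρ_n and relations ρ_1 ρ_n ρ_i = ρ_{i+1} ρ_n for 1 ≤ i ≤ n−1, onto the (n, n+1)-torus knot group G(n, n+1), defined as the group with presentation ⟨x, y | x^n = y^{n+1}⟩. -/
/-- The defining relators of the group with presentation
`⟨ρ_1, …, ρ_n | ρ_1 ρ_n ρ_i = ρ_{i+1} ρ_n for 1 ≤ i ≤ n-1⟩`, where the generator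
`k : Fin n` represents `ρ_{k+1}`. -/
def MnGrpRels (n : ℕ) : Set (FreeGroup (Fin n)) :=
  { r | ∃ (i : ℕ) (h1 : 1 ≤ i) (h2 : i ≤ n - 1),
      r = FreeGroup.of ⟨1 - 1, by omega⟩ * FreeGroup.of ⟨n - 1, by omega⟩ *
            FreeGroup.of ⟨i - 1, by omega⟩ *
          (FreeGroup.of ⟨i + 1 - 1, by omega⟩ * FreeGroup.of ⟨n - 1, by omega⟩)⁻¹ }

/-- The generator `ρ_i`, for `1 ≤ i ≤ n` (junk value `1` out of range). -/
def rhoG (n : ℕ) (i : ℕ) : PresentedGroup (MnGrpRels n) :=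
  if h : 1 ≤ i ∧ i ≤ n then PresentedGroup.of ⟨i - 1, by omega⟩ else 1

/-- The relator of the `(n, n+1)`-torus knot group `⟨x, y | x^n = y^{n+1}⟩`; the generator
`0 : Fin 2` represents `x` and `1 : Fin 2` represents `y`. -/
def TorusRels (n : ℕ) : Set (FreeGroup (Fin 2)) :=
  { FreeGroup.of 0 ^ n * (FreeGroup.of 1 ^ (n + 1))⁻¹ }

theorem rhoG_step (n i : ℕ) (h1 : 1 ≤ i) (h2 : i ≤ n - 1) :
    rhoG n 1 * rhoG n n * rhoG n i = rhoG n (i + 1) * rhoG n n := by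
  have h : (FreeGroup.of ⟨1 - 1, by omega⟩ * FreeGroup.of ⟨n - 1, by omega⟩ *
            FreeGroup.of ⟨i - 1, by omega⟩ *
          (FreeGroup.of ⟨i + 1 - 1, by omega⟩ * FreeGroup.of ⟨n - 1, by omega⟩)⁻¹ :
          FreeGroup (Fin n)) ∈ MnGrpRels n := ⟨i, h1, h2, rfl⟩
  have h' := PresentedGroup.one_of_mem h
  rw [map_mul, map_inv, mul_inv_eq_one, map_mul, map_mul, map_mul] at h'
  unfold rhoG
  rw [dif_pos ⟨le_refl 1, by omega⟩, dif_pos ⟨by omega, le_refl n⟩,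
    dif_pos ⟨h1, by omega⟩, dif_pos ⟨by omega, by omega⟩]
  exact h'

theorem rhoG_eq (n i : ℕ) (h1 : 1 ≤ i) (h2 : i ≤ n) :
    rhoG n i = (rhoG n 1 * rhoG n n) ^ i * (rhoG n n ^ i)⁻¹ := by
  induction i, h1 using Nat.le_induction with
  | base => simp
  | succ i h1 ih =>
    have h := rhoG_step n i h1 (by omega)
    rw [← mul_inv_eq_iff_eq_mul.mpr h]
    rw [ih (by omega), pow_succ' (rhoG n 1 * rhoG n n), pow_succ' (rhoG n n)]
    simp only [mul_inv_rev, mul_assoc]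

theorem torus_rel (n : ℕ) :
    (PresentedGroup.of (0 : Fin 2) : PresentedGroup (TorusRels n)) ^ n =
      PresentedGroup.of (1 : Fin 2) ^ (n + 1) := by
  have h' := PresentedGroup.one_of_mem (rels := TorusRels n) (Set.mem_singleton _)
  rw [map_mul, map_inv, mul_inv_eq_one, map_pow, map_pow] at h'
  exact h'

/-- The assignment `ρ_i ↦ x^i y^{-i}` extends to a group isomorphism from the group
`⟨ρ_1, …, ρ_n | ρ_1 ρ_n ρ_i = ρ_{i+1} ρ_n⟩` onto the `(n, n+1)`-torus knot group. -/
theorem stmt11 (n : ℕ) (hn : 1 ≤ n) :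
    ∃ e : PresentedGroup (MnGrpRels n) ≃* PresentedGroup (TorusRels n),
      ∀ i : ℕ, 1 ≤ i → i ≤ n →
        e (rhoG n i) =
          (PresentedGroup.of (0 : Fin 2) : PresentedGroup (TorusRels n)) ^ i *
            ((PresentedGroup.of (1 : Fin 2) : PresentedGroup (TorusRels n)) ^ i)⁻¹ := by
  set x : PresentedGroup (TorusRels n) := PresentedGroup.of (0 : Fin 2) with hx
  set y : PresentedGroup (TorusRels n) := PresentedGroup.of (1 : Fin 2) with hy
  have hxy : x ^ n = y ^ (n + 1) := torus_rel n
  have hn' : x ^ n * (y ^ n)⁻¹ = y := by rw [hxy, pow_succ']; group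
  let F : PresentedGroup (MnGrpRels n) →* PresentedGroup (TorusRels n) :=
    PresentedGroup.toGroup (f := fun k : Fin n => x ^ (k.1 + 1) * (y ^ (k.1 + 1))⁻¹) (by
      rintro r ⟨i, h1, h2, rfl⟩
      rw [map_mul, map_inv, mul_inv_eq_one]
      simp only [map_mul, FreeGroup.lift_apply_of, Nat.sub_add_cancel hn,
        Nat.sub_add_cancel h1, Nat.add_sub_cancel, hn', Nat.sub_self]
      rw [pow_succ' x i, pow_succ' y i]
      group)
  have hF : ∀ i : ℕ, 1 ≤ i → i ≤ n → F (rhoG n i) = x ^ i * (y ^ i)⁻¹ := by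
    intro i h1 h2
    unfold rhoG
    rw [dif_pos ⟨h1, h2⟩]
    simp only [F, PresentedGroup.toGroup.of, Nat.sub_add_cancel h1]
  have hY : rhoG n n = (rhoG n 1 * rhoG n n) ^ n * (rhoG n n ^ n)⁻¹ :=
    rhoG_eq n n hn le_rfl
  let G : PresentedGroup (TorusRels n) →* PresentedGroup (MnGrpRels n) :=
    PresentedGroup.toGroup (f := ![rhoG n 1 * rhoG n n, rhoG n n]) (by
      rintro r rfl
      rw [map_mul, map_inv, mul_inv_eq_one]
      simp only [map_pow, FreeGroup.lift_apply_of, Matrix.cons_val_zero, Matrix.cons_val_one]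
      rw [eq_mul_inv_iff_mul_eq] at hY
      rw [← hY, pow_succ'])
  have hGx : G x = rhoG n 1 * rhoG n n := by simp [G, hx]
  have hGy : G y = rhoG n n := by simp [G, hy]
  refine ⟨MonoidHom.toMulEquiv F G ?_ ?_, hF⟩
  · apply PresentedGroup.ext
    intro k
    have hk : (PresentedGroup.of k : PresentedGroup (MnGrpRels n)) = rhoG n (k.1 + 1) := by
      unfold rhoG
      rw [dif_pos ⟨by omega, k.2⟩]
      rfl
    rw [hk, MonoidHom.comp_apply, hF _ (by omega) k.2, map_mul, map_inv, map_pow, map_pow,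
      hGx, hGy, ← rhoG_eq n _ (by omega) k.2]
    rfl
  · apply PresentedGroup.ext
    intro k
    have hFn : F (rhoG n n) = y := by rw [hF n hn le_rfl, hn']
    fin_cases k
    · change F (G x) = x
      rw [hGx, map_mul, hFn, hF 1 le_rfl hn]
      group
    · change F (G y) = y
      rw [hGy, hFn]
end

section
/- For every integer n ≥ 1, the assignment ρ_i ↦ σ_1 σ_2 ⋯ σ_i (for 1 ≤ i ≤ n) extends to a surjective group homomorphism from the group defined by the presentation with generators ρ_1, …, ρ_n and relations ρ_1 ρ_n ρ_i = ρ_{i+1} ρ_n for 1 ≤ i ≤ n−1, onto the braid group B_{n+1}. -/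
/-- The defining relators of the braid group `B_{n+1}` on `n+1` strands: the generator
`k : Fin n` represents `σ_{k+1}`, and the relations are
`σ_i σ_{i+1} σ_i = σ_{i+1} σ_i σ_{i+1}` for `1 ≤ i < n` and `σ_i σ_j = σ_j σ_i` for
`|i - j| > 1`. -/
def BraidRels (n : ℕ) : Set (FreeGroup (Fin n)) :=
  { r | (∃ (i : ℕ) (h1 : 1 ≤ i) (h2 : i < n),
          r = FreeGroup.of ⟨i - 1, by omega⟩ * FreeGroup.of ⟨i + 1 - 1, by omega⟩ *
                FreeGroup.of ⟨i - 1, by omega⟩ *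
              (FreeGroup.of ⟨i + 1 - 1, by omega⟩ * FreeGroup.of ⟨i - 1, by omega⟩ *
                FreeGroup.of ⟨i + 1 - 1, by omega⟩)⁻¹) ∨
        (∃ (i j : ℕ) (hi1 : 1 ≤ i) (hi2 : i ≤ n) (hj1 : 1 ≤ j) (hj2 : j ≤ n),
          (i + 1 < j ∨ j + 1 < i) ∧
          r = FreeGroup.of ⟨i - 1, by omega⟩ * FreeGroup.of ⟨j - 1, by omega⟩ *
              (FreeGroup.of ⟨j - 1, by omega⟩ * FreeGroup.of ⟨i - 1, by omega⟩)⁻¹) }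

/-- The braid group on `n+1` strands, as a presented group. -/
abbrev Braid (n : ℕ) := PresentedGroup (BraidRels n)

/-- The Artin generator `σ_k` of the braid group `B_{n+1}`, for `1 ≤ k ≤ n`
(junk value `1` out of range). -/
def sigmaB (n : ℕ) (k : ℕ) : Braid n :=
  if h : 1 ≤ k ∧ k ≤ n then PresentedGroup.of ⟨k - 1, by omega⟩ else 1

/-- The product `σ_1 σ_2 ⋯ σ_i` in the braid group `B_{n+1}`. -/
def Sprod (n : ℕ) (i : ℕ) : Braid n :=
  ((List.range i).map (fun t => sigmaB n (t + 1))).prod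

theorem aux_sigma_braid (n i : ℕ) (h1 : 1 ≤ i) (h2 : i < n) :
    sigmaB n i * sigmaB n (i + 1) * sigmaB n i =
      sigmaB n (i + 1) * sigmaB n i * sigmaB n (i + 1) := by
  have h : (PresentedGroup.mk (BraidRels n)) _ = 1 :=
    PresentedGroup.one_of_mem (rels := BraidRels n) (Or.inl ⟨i, h1, h2, rfl⟩)
  rw [map_mul, map_inv, mul_inv_eq_one] at h
  simp only [map_mul] at h
  unfold sigmaB
  rw [dif_pos ⟨h1, h2.le⟩, dif_pos (⟨by omega, by omega⟩ : 1 ≤ i + 1 ∧ i + 1 ≤ n)]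
  exact h

theorem aux_sigma_comm (n i j : ℕ) (hi1 : 1 ≤ i) (hi2 : i ≤ n) (hj1 : 1 ≤ j) (hj2 : j ≤ n)
    (hij : i + 1 < j ∨ j + 1 < i) :
    sigmaB n i * sigmaB n j = sigmaB n j * sigmaB n i := by
  have h : (PresentedGroup.mk (BraidRels n)) _ = 1 :=
    PresentedGroup.one_of_mem (rels := BraidRels n)
      (Or.inr ⟨i, j, hi1, hi2, hj1, hj2, hij, rfl⟩)
  rw [map_mul, map_inv, mul_inv_eq_one] at h
  simp only [map_mul] at h
  unfold sigmaB
  rw [dif_pos ⟨hi1, hi2⟩, dif_pos ⟨hj1, hj2⟩]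
  exact h

theorem aux_Sprod_zero (n : ℕ) : Sprod n 0 = 1 := by simp [Sprod]

theorem aux_Sprod_succ (n i : ℕ) : Sprod n (i + 1) = Sprod n i * sigmaB n (i + 1) := by
  simp [Sprod, List.range_succ]

theorem aux_Sprod_comm (n i j : ℕ) (hj : j ≤ n) (hij : i + 1 < j) :
    Sprod n i * sigmaB n j = sigmaB n j * Sprod n i := by
  induction i with
  | zero => simp [aux_Sprod_zero]
  | succ k ih =>
    rw [aux_Sprod_succ, mul_assoc, aux_sigma_comm n (k + 1) j (by omega) (by omega) (by omega) hj
      (by omega), ← mul_assoc, ih (by omega), mul_assoc]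

theorem aux_shift (n i m : ℕ) (hi : 1 ≤ i) (him : i + 1 ≤ m) (hm : m ≤ n) :
    Sprod n m * sigmaB n i = sigmaB n (i + 1) * Sprod n m := by
  induction m, him using Nat.le_induction with
  | base =>
    obtain ⟨k, rfl⟩ : ∃ k, i = k + 1 := ⟨i - 1, by omega⟩
    have hb := aux_sigma_braid n (k + 1) hi (by omega)
    have hc := aux_Sprod_comm n k (k + 1 + 1) hm (by omega)
    rw [aux_Sprod_succ n (k + 1), aux_Sprod_succ n k]
    calc Sprod n k * sigmaB n (k + 1) * sigmaB n (k + 1 + 1) * sigmaB n (k + 1)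
        = Sprod n k * (sigmaB n (k + 1) * sigmaB n (k + 1 + 1) * sigmaB n (k + 1)) := by
          simp only [mul_assoc]
      _ = (Sprod n k * sigmaB n (k + 1 + 1)) * (sigmaB n (k + 1) * sigmaB n (k + 1 + 1)) := by
          rw [hb]; simp only [mul_assoc]
      _ = _ := by rw [hc]; simp only [mul_assoc]
  | succ m hm' ih =>
    rw [aux_Sprod_succ, mul_assoc, aux_sigma_comm n (m + 1) i (by omega) hm hi (by omega)
      (by omega), ← mul_assoc, ih (by omega), mul_assoc]

theorem aux_rel (n i : ℕ) (hi : i + 1 ≤ n) :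
    Sprod n 1 * Sprod n n * Sprod n i = Sprod n (i + 1) * Sprod n n := by
  induction i with
  | zero => simp [aux_Sprod_zero]
  | succ k ih =>
    rw [aux_Sprod_succ n k, ← mul_assoc, ih (by omega), mul_assoc,
      aux_shift n (k + 1) n (by omega) hi le_rfl, ← mul_assoc, ← aux_Sprod_succ]

/-- The assignment `ρ_i ↦ σ_1 σ_2 ⋯ σ_i` extends to a surjective group homomorphism from the
group `⟨ρ_1, …, ρ_n | ρ_1 ρ_n ρ_i = ρ_{i+1} ρ_n⟩` onto the braid group `B_{n+1}`. -/
theorem stmt12 (n : ℕ) (hn : 1 ≤ n) :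
    ∃ f : PresentedGroup (MnGrpRels n) →* Braid n,
      Function.Surjective f ∧ ∀ i : ℕ, 1 ≤ i → i ≤ n → f (rhoG n i) = Sprod n i := by
  have hrel : ∀ r ∈ MnGrpRels n,
      FreeGroup.lift (fun k : Fin n => Sprod n (k.1 + 1)) r = 1 := by
    rintro r ⟨i, h1, h2, rfl⟩
    rw [map_mul, map_inv, mul_inv_eq_one]
    simp only [map_mul, FreeGroup.lift_apply_of]
    have e1 : n - 1 + 1 = n := by omega
    have e2 : i - 1 + 1 = i := by omega
    have e3 : i + 1 - 1 + 1 = i + 1 := by omega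
    rw [e1, e2, e3]
    exact aux_rel n i (by omega)
  have hval : ∀ i : ℕ, 1 ≤ i → i ≤ n →
      PresentedGroup.toGroup hrel (rhoG n i) = Sprod n i := by
    intro i h1 h2
    unfold rhoG
    rw [dif_pos ⟨h1, h2⟩, PresentedGroup.toGroup.of]
    have e2 : i - 1 + 1 = i := by omega
    simp only [e2]
  refine ⟨PresentedGroup.toGroup hrel, ?_, hval⟩
  rw [← MonoidHom.range_eq_top, eq_top_iff, ← PresentedGroup.closure_range_of,
    Subgroup.closure_le]
  have hS : ∀ i ≤ n, Sprod n i ∈ (PresentedGroup.toGroup hrel).range := by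
    intro i hi
    rcases Nat.eq_zero_or_pos i with rfl | h
    · rw [aux_Sprod_zero]; exact one_mem _
    · exact ⟨_, hval i h hi⟩
  rintro _ ⟨k, rfl⟩
  have hk : PresentedGroup.of k = (Sprod n k.1)⁻¹ * Sprod n (k.1 + 1) := by
    rw [aux_Sprod_succ, inv_mul_cancel_left]
    unfold sigmaB
    rw [dif_pos ⟨by omega, by omega⟩]
    rfl
  rw [hk]
  exact mul_mem (inv_mem (hS _ k.2.le)) (hS _ k.2)
end
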